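/- Let L_n denote the lexicographically least binary de Bruijn sequence of order n. There exists a constant C > 0 such that for all n ≥ 2, disc(L_n) ≤ C · 2^n · log n / n (logarithm natural). -/

import Mathlib

/-- All binary words of length `n` (`false` = 0, `true` = 1), listed in lexicographic order. -/
def allWords : ℕ → List (List Bool)
  | 0 => [[]]
  | n + 1 => (allWords n).flatMap (fun w => [w ++ [false], w ++ [true]])

/-- The skew of a binary word: number of 0s minus number of 1s. -/
def skew (w : List Bool) : ℤ := (w.map (fun b => if b then (-1 : ℤ) else 1)).sum

/-- The discrepancy of a binary word: the maximum over all (nonempty) initial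
segments of the absolute difference between the number of 0s and of 1s. -/
def disc (w : List Bool) : ℤ :=
  ((List.range w.length).map (fun M => |skew (w.take (M + 1))|)).foldr max 0

/-- `w` contains a run of `k` consecutive 0s. -/
def hasZeroRun (k : ℕ) (w : List Bool) : Prop := List.replicate k false <:+: w

instance (k : ℕ) : DecidablePred (hasZeroRun k) := fun _ => inferInstanceAs (Decidable (_ <:+: _))

/-- Number of binary words of length `n` containing no run of `k` consecutive 0s. -/
def alpha (k n : ℕ) : ℕ := ((allWords n).filter (fun w => !decide (hasZeroRun k w))).length

/-- Sum of the skews of all binary words of length `n` containing no run of `k` consecutive 0s. -/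
def beta (k n : ℕ) : ℤ :=
  (((allWords n).filter (fun w => !decide (hasZeroRun k w))).map skew).sum

/-- Strict lexicographic order on binary words, with 0 < 1. -/
def lexLt (u v : List Bool) : Prop := List.Lex (· < ·) u v

instance : DecidableRel lexLt := fun _ _ => inferInstanceAs (Decidable (List.Lex _ _ _))

/-- Weak lexicographic order on binary words. -/
def lexLe (u v : List Bool) : Prop := lexLt u v ∨ u = v

instance : DecidableRel lexLe := fun _ _ => inferInstanceAs (Decidable (_ ∨ _))

/-- A binary Lyndon word: nonempty and strictly lexicographically smaller than
each of its nontrivial cyclic rotations. -/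
def IsLyndon (w : List Bool) : Prop :=
  w ≠ [] ∧ ∀ i ∈ Finset.Ico 1 w.length, lexLt w (w.rotate i)

instance : DecidablePred IsLyndon := fun _ => inferInstanceAs (Decidable (_ ∧ _))

/-- `ell n k`: the concatenation, in lexicographic order, of all binary Lyndon words of
length `n` whose longest run of consecutive 0s has length exactly `k`. -/
def ell (n k : ℕ) : List Bool :=
  (List.insertionSort lexLe ((allWords n).filter (fun w =>
    decide (IsLyndon w) && decide (hasZeroRun k w) && !decide (hasZeroRun (k + 1) w)))).flatten

/-- `LWord n`: the lexicographically least binary de Bruijn sequence of order `n`, i.e. the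
concatenation, in lexicographic order, of all binary Lyndon words of length dividing `n`. -/
def LWord (n : ℕ) : List Bool :=
  (List.insertionSort lexLe (((List.range (n + 1)).flatMap allWords).filter
    (fun w => decide (IsLyndon w) && decide (w.length ∣ n)))).flatten

/-- The number of occurrences of `0^k` as a subword of `w`. -/
def occCount (k : ℕ) (w : List Bool) : ℕ :=
  ((List.range (w.length + 1)).filter
    (fun i => decide (List.replicate k false <+: w.drop i))).length

section

open Finset

/-- The sign of a letter: `1` for the letter `0`, `-1` for the letter `1`. -/
def letterSign (b : Bool) : ℤ := if b then -1 else 1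

/-- The cyclic words of length `n` having a rotation whose periodic extension is
lexicographically smaller than `v`. -/
noncomputable def rotationBelow (n : ℕ) [NeZero n] (v : ℕ → Bool) : Finset (ZMod n → Bool) :=
  open Classical in {u | ∃ r : ZMod n, toLex (fun j : ℕ => u (r + j)) < toLex v}

/-- The cyclic words of length `n` containing the first `K` letters of `v`. -/
noncomputable def containsPrefix (n : ℕ) [NeZero n] (v : ℕ → Bool) (K : ℕ) :
    Finset (ZMod n → Bool) :=
  open Classical in {u | ∃ r : ZMod n, ∀ j < K, u (r + j) = v j}

/-- The cyclic word `u` with the letter at position `i` changed. -/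
def flipAt {n : ℕ} (u : ZMod n → Bool) (i : ZMod n) : ZMod n → Bool :=
  Function.update u i (!u i)

theorem flipAt_flipAt {n : ℕ} (u : ZMod n → Bool) (i : ZMod n) : flipAt (flipAt u i) i = u := by
  simp [flipAt]

theorem flipAt_ne {n : ℕ} (u : ZMod n → Bool) (i : ZMod n) : flipAt u i ≠ u := by
  intro h
  have := congrFun h i
  simp [flipAt] at this

theorem letterSign_flipAt {n : ℕ} (u : ZMod n → Bool) (i : ZMod n) :
    letterSign (flipAt u i i) = -letterSign (u i) := by
  cases h : u i <;> simp [flipAt, letterSign, h]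

theorem abs_letterSign (b : Bool) : |letterSign b| = 1 := by
  cases b <;> simp [letterSign]

theorem abs_sum_letterSign_le {n : ℕ} [NeZero n] (T : Finset (ZMod n → Bool)) (i : ZMod n) :
    |∑ u ∈ T, letterSign (u i)| ≤ #{u ∈ T | flipAt u i ∉ T} := by
  rw [← sum_filter_add_sum_filter_not T (fun u => flipAt u i ∈ T)]
  have h0 : ∑ u ∈ T with flipAt u i ∈ T, letterSign (u i) = 0 := by
    refine sum_involution (fun u _ => flipAt u i) ?_ ?_ ?_ ?_
    · intro u _
      rw [letterSign_flipAt]; ring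
    · intro u _ _
      exact flipAt_ne u i
    · intro u hu
      simpa [flipAt_flipAt, and_comm] using hu
    · intro u _
      exact flipAt_flipAt u i
  rw [h0, zero_add]
  refine (abs_sum_le_sum_abs _ _).trans ?_
  simp [abs_letterSign]

theorem card_pivotal_le {n : ℕ} [NeZero n] (v : ℕ → Bool) (K : ℕ) {u : ZMod n → Bool}
    (hu : u ∈ rotationBelow n v) (hK : u ∉ containsPrefix n v K) :
    #{i | flipAt u i ∉ rotationBelow n v} ≤ K := by
  classical
  simp only [rotationBelow, mem_filter, mem_univ, true_and] at hu
  obtain ⟨r, p, hp, hlt⟩ := hu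
  have hpK : p < K := by
    by_contra h
    apply hK
    simp only [containsPrefix, mem_filter, mem_univ, true_and]
    exact ⟨r, fun j hj => hp j (by omega)⟩
  have hsub : ({i | flipAt u i ∉ rotationBelow n v} : Finset (ZMod n)) ⊆
      (range (p + 1)).image (fun j : ℕ => r + (j : ZMod n)) := by
    intro i hi
    by_contra hni
    simp only [mem_filter, mem_univ, true_and] at hi
    apply hi
    have hsame : ∀ j ≤ p, flipAt u i (r + (j : ZMod n)) = u (r + j) := by
      intro j hj
      refine Function.update_of_ne ?_ _ _
      rintro rfl
      exact hni (mem_image.2 ⟨j, by simp; omega, rfl⟩)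
    simp only [rotationBelow, mem_filter, mem_univ, true_and]
    refine ⟨r, p, fun j hj => (hsame j hj.le).trans (hp j hj), ?_⟩
    change flipAt u i (r + (p : ZMod n)) < v p
    rw [hsame p le_rfl]
    exact hlt
  calc _ ≤ _ := card_le_card hsub
    _ ≤ p + 1 := card_image_le.trans (by simp)
    _ ≤ K := hpK

theorem sum_card_pivotal_le {n : ℕ} [NeZero n] (v : ℕ → Bool) (K : ℕ) :
    ∑ u ∈ rotationBelow n v, #{i | flipAt u i ∉ rotationBelow n v} ≤
      2 ^ n * K + n * #(containsPrefix n v K) := by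
  classical
  calc _ ≤ ∑ u ∈ rotationBelow n v, (K + if u ∈ containsPrefix n v K then n else 0) := by
        refine sum_le_sum fun u hu => ?_
        split_ifs with h
        · exact (card_filter_le _ _).trans (by simp [ZMod.card])
        · simpa using card_pivotal_le v K hu h
    _ ≤ ∑ u : ZMod n → Bool, (K + if u ∈ containsPrefix n v K then n else 0) :=
        sum_le_sum_of_subset (subset_univ _)
    _ = _ := by
        rw [sum_add_distrib, sum_const, ← sum_filter, sum_const]
        simp [ZMod.card, mul_comm]

theorem card_containsPrefix_le {n : ℕ} [NeZero n] (v : ℕ → Bool) {K : ℕ} (hK : K ≤ n) :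
    #(containsPrefix n v K) * 2 ^ K ≤ n * 2 ^ n := by
  classical
  have hfix (r : ZMod n) :
      #{u : ZMod n → Bool | ∀ j < K, u (r + j) = v j} * 2 ^ K ≤ 2 ^ n := by
    set W : Finset (ZMod n) := (range K).image (fun j : ℕ => r + (j : ZMod n)) with hW
    have hval (j : ℕ) (hj : j < K) : (j : ZMod n).val = j := by
      rw [ZMod.val_natCast, Nat.mod_eq_of_lt (by omega)]
    have hWcard : #W = K := by
      rw [hW, card_image_of_injOn, card_range]
      intro a ha b hb hab
      have := congrArg ZMod.val (add_left_cancel hab)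
      rwa [hval a (by simpa using ha), hval b (by simpa using hb)] at this
    have hsub : ({u : ZMod n → Bool | ∀ j < K, u (r + j) = v j} : Finset _) ⊆
        Fintype.piFinset (fun z => if z ∈ W then {v (z - r).val} else univ) := by
      intro u hu
      simp only [mem_filter, mem_univ, true_and] at hu
      rw [Fintype.mem_piFinset]
      intro z
      split_ifs with hz
      · obtain ⟨j, hj, rfl⟩ := mem_image.1 hz
        have hj' : j < K := by simpa using hj
        rw [mem_singleton, hu j hj', add_sub_cancel_left, hval j hj']
      · simp
    have hcard : #(Fintype.piFinset (fun z => if z ∈ W then {v (z - r).val} else univ)) =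
        2 ^ #Wᶜ := by
      rw [Fintype.card_piFinset, ← prod_const, ← prod_subset (subset_univ Wᶜ)]
      · refine prod_congr rfl fun z hz => ?_
        rw [if_neg (by simpa using hz)]; simp
      · intro z _ hz
        rw [if_pos (by simpa using hz)]; simp
    calc _ ≤ 2 ^ #Wᶜ * 2 ^ K := Nat.mul_le_mul_right _ ((card_le_card hsub).trans hcard.le)
      _ = 2 ^ n := by
        rw [← pow_add, card_compl, hWcard, ZMod.card, Nat.sub_add_cancel hK]
  have hun : containsPrefix n v K ⊆
      univ.biUnion (fun r : ZMod n => {u : ZMod n → Bool | ∀ j < K, u (r + j) = v j}) := by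
    intro u hu
    simpa [containsPrefix] using hu
  calc _ ≤ (∑ r : ZMod n, #{u : ZMod n → Bool | ∀ j < K, u (r + j) = v j}) * 2 ^ K :=
        Nat.mul_le_mul_right _ ((card_le_card hun).trans card_biUnion_le)
    _ = ∑ r : ZMod n, #{u : ZMod n → Bool | ∀ j < K, u (r + j) = v j} * 2 ^ K := sum_mul _ _ _
    _ ≤ ∑ r : ZMod n, 2 ^ n := sum_le_sum fun r _ => hfix r
    _ = _ := by simp [ZMod.card]

/-- The total skew of the cyclic words with a rotation below `v` is at most the total influence
of this family, which is `O(2 ^ n * log n)`. -/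
theorem abs_sum_rotationBelow_le {n : ℕ} [NeZero n] (v : ℕ → Bool) {K : ℕ} (hK : n ^ 2 ≤ 2 ^ K) :
    |∑ u ∈ rotationBelow n v, ∑ i, letterSign (u i)| ≤ 2 ^ n * (K + 1) := by
  classical
  have hn : 0 < n := Nat.pos_of_ne_zero (NeZero.ne n)
  have hpiv : ∑ u ∈ rotationBelow n v, #{i | flipAt u i ∉ rotationBelow n v} ≤
      2 ^ n * (K + 1) := by
    rcases le_total K n with h | h
    · refine (sum_card_pivotal_le v K).trans ?_
      have h1 := card_containsPrefix_le v h
      have h2 : n * #(containsPrefix n v K) ≤ 2 ^ n := by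
        refine Nat.le_of_mul_le_mul_left ?_ hn
        calc n * (n * #(containsPrefix n v K)) = #(containsPrefix n v K) * n ^ 2 := by ring
          _ ≤ #(containsPrefix n v K) * 2 ^ K := Nat.mul_le_mul_left _ hK
          _ ≤ _ := h1
      linarith
    · calc _ ≤ ∑ u ∈ rotationBelow n v, n :=
            sum_le_sum fun u _ => (card_filter_le _ _).trans (by simp [ZMod.card])
        _ ≤ ∑ u : ZMod n → Bool, n := sum_le_sum_of_subset (subset_univ _)
        _ = 2 ^ n * n := by simp [ZMod.card]
        _ ≤ _ := Nat.mul_le_mul_left _ (by omega)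
  rw [sum_comm]
  calc _ ≤ ∑ i, |∑ u ∈ rotationBelow n v, letterSign (u i)| := abs_sum_le_sum_abs _ _
    _ ≤ ∑ i, (#{u ∈ rotationBelow n v | flipAt u i ∉ rotationBelow n v} : ℤ) :=
        sum_le_sum fun i _ => abs_sum_letterSign_le _ i
    _ = ((∑ u ∈ rotationBelow n v, #{i | flipAt u i ∉ rotationBelow n v} : ℕ) : ℤ) := by
        push_cast [card_filter]
        rw [sum_comm]
    _ ≤ _ := by exact_mod_cast hpiv

/-- The periodic extension of a word. -/
def periodicExt (w : List Bool) (j : ℕ) : Bool := w.getD (j % w.length) false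

theorem periodic_periodicExt (w : List Bool) : Function.Periodic (periodicExt w) w.length := by
  intro j
  simp [periodicExt]

theorem periodicExt_of_lt {w : List Bool} {j : ℕ} (hj : j < w.length) :
    periodicExt w j = w[j] := by
  simp [periodicExt, Nat.mod_eq_of_lt hj, hj]

theorem periodicExt_rotate (w : List Bool) (hw : w ≠ []) (i : ℕ) :
    periodicExt (w.rotate i) = fun j => periodicExt w (j + i) := by
  have hl : 0 < w.length := List.length_pos_iff.2 hw
  funext j
  have h1 : j % w.length < (w.rotate i).length := by simpa using Nat.mod_lt _ hl
  have h2 : (j + i) % w.length < w.length := Nat.mod_lt _ hl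
  simp [periodicExt, List.getElem?_eq_getElem h1, List.getElem_rotate,
    List.getElem?_eq_getElem h2]

theorem lexLt_iff_lt (u v : List Bool) : lexLt u v ↔ u < v := Iff.rfl

theorem lexLt_iff_of_length_eq {u v : List Bool} (h : u.length = v.length) :
    lexLt u v ↔ toLex (periodicExt u) < toLex (periodicExt v) := by
  have key : ∀ {u v : List Bool}, u.length = v.length → u < v →
      toLex (periodicExt u) < toLex (periodicExt v) := by
    intro u v h huv
    rcases List.lt_iff_exists.1 huv with ⟨-, h'⟩ | ⟨i, h₁, h₂, hj, hi⟩
    · omega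
    · refine ⟨i, fun j hji => ?_, ?_⟩
      · change periodicExt u j = periodicExt v j
        rw [periodicExt_of_lt (hji.trans h₁), periodicExt_of_lt (hji.trans h₂), hj j hji]
      · change periodicExt u i < periodicExt v i
        rwa [periodicExt_of_lt h₁, periodicExt_of_lt h₂]
  rw [lexLt_iff_lt]
  refine ⟨key h, fun hlt => ?_⟩
  rcases lt_trichotomy u v with h' | rfl | h'
  · exact h'
  · exact absurd hlt (lt_irrefl _)
  · exact absurd hlt (key h.symm h').asymm

theorem isLyndon_iff {w : List Bool} : IsLyndon w ↔ w ≠ [] ∧ ∀ i, 0 < i → i < w.length →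
    toLex (periodicExt w) < toLex (fun j => periodicExt w (j + i)) := by
  refine and_congr_right fun hw => ?_
  simp only [mem_Ico, and_imp]
  refine forall_congr' fun i => forall_congr' fun _ => forall_congr' fun _ => ?_
  rw [lexLt_iff_of_length_eq (by simp), periodicExt_rotate w hw]

theorem IsLyndon.length_pos {w : List Bool} (hw : IsLyndon w) : 0 < w.length :=
  List.length_pos_iff.2 hw.1

theorem IsLyndon.le_shift {w : List Bool} (hw : IsLyndon w) (i : ℕ) :
    toLex (periodicExt w) ≤ toLex (fun j => periodicExt w (j + i)) := by
  have h : (fun j => periodicExt w (j + i)) = fun j => periodicExt w (j + i % w.length) := by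
    funext j
    rw [← (periodic_periodicExt w).map_mod_nat, ← (periodic_periodicExt w).map_mod_nat (j + _)]
    simp
  rw [h]
  rcases Nat.eq_zero_or_pos (i % w.length) with h0 | h0
  · simp [h0]
  · exact ((isLyndon_iff.1 hw).2 _ h0 (Nat.mod_lt _ hw.length_pos)).le

theorem IsLyndon.eq_zero_of_shift_eq {w : List Bool} (hw : IsLyndon w) {i : ℕ}
    (hi : i < w.length) (h : ∀ j, periodicExt w (j + i) = periodicExt w j) : i = 0 := by
  by_contra h0
  have := (isLyndon_iff.1 hw).2 i (Nat.pos_of_ne_zero h0) hi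
  rw [funext h] at this
  exact lt_irrefl _ this

theorem IsLyndon.eq_of_periodicExt_eq {u v : List Bool} (hu : IsLyndon u) (hv : IsLyndon v)
    (h : periodicExt u = periodicExt v) : u = v := by
  have key : ∀ {u v : List Bool}, IsLyndon u → IsLyndon v → periodicExt u = periodicExt v →
      v.length ≤ u.length := by
    intro u v hu hv h
    by_contra! hlt
    have := hv.eq_zero_of_shift_eq hlt (by rw [← h]; exact periodic_periodicExt u)
    have := hu.length_pos
    omega
  refine List.ext_getElem (le_antisymm (key hv hu h.symm) (key hu hv h)) fun i h₁ h₂ => ?_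
  rw [← periodicExt_of_lt h₁, ← periodicExt_of_lt h₂, h]

/-- On Lyndon words, the lexicographic order agrees with that of the periodic extensions. -/
theorem lexLt_iff_of_isLyndon {u v : List Bool} (hu : IsLyndon u) (hv : IsLyndon v) :
    lexLt u v ↔ toLex (periodicExt u) < toLex (periodicExt v) := by
  have key : ∀ {u v : List Bool}, IsLyndon u → IsLyndon v → u < v →
      toLex (periodicExt u) < toLex (periodicExt v) := by
    intro u v hu hv huv
    rcases List.lt_iff_exists.1 huv with ⟨htake, hlen⟩ | ⟨i, h₁, h₂, hj, hi⟩
    · obtain ⟨p, hp, hlt⟩ := (isLyndon_iff.1 hv).2 u.length hu.length_pos hlen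
      change ∀ j < p, periodicExt v j = periodicExt v (j + u.length) at hp
      change periodicExt v p < periodicExt v (p + u.length) at hlt
      have hagree : ∀ j < p + u.length, periodicExt u j = periodicExt v j := by
        intro j
        induction j using Nat.strong_induction_on with
        | _ j ih =>
          intro hjp
          rcases lt_or_ge j u.length with hju | hju
          · rw [periodicExt_of_lt hju, periodicExt_of_lt (hju.trans hlen)]
            have : u[j] = (v.take u.length)[j]'(by simp; omega) := by congr 1
            rw [this, List.getElem_take]
          · obtain ⟨k, rfl⟩ := Nat.exists_eq_add_of_le' hju
            have := hu.length_pos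
            rw [periodic_periodicExt u, ih k (by omega) (by omega), hp k (by omega)]
      refine ⟨p + u.length, hagree, ?_⟩
      change periodicExt u _ < periodicExt v _
      rw [periodic_periodicExt u, hagree p (by have := hu.length_pos; omega)]
      exact hlt
    · refine ⟨i, fun j hji => ?_, ?_⟩
      · change periodicExt u j = periodicExt v j
        rw [periodicExt_of_lt (hji.trans h₁), periodicExt_of_lt (hji.trans h₂), hj j hji]
      · change periodicExt u i < periodicExt v i
        rwa [periodicExt_of_lt h₁, periodicExt_of_lt h₂]
  rw [lexLt_iff_lt]
  refine ⟨key hu hv, fun hlt => ?_⟩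
  rcases lt_trichotomy u v with h' | rfl | h'
  · exact h'
  · exact absurd hlt (lt_irrefl _)
  · exact absurd hlt (key hv hu h').asymm

/-- A sequence with period `n` that is minimal among its shifts is the periodic extension of a
Lyndon word of length dividing `n`. -/
theorem exists_isLyndon_periodicExt_eq {n : ℕ} (hn : 0 < n) {m : ℕ → Bool}
    (hm : Function.Periodic m n) (hmin : ∀ i, toLex m ≤ toLex (fun j => m (j + i))) :
    ∃ w, IsLyndon w ∧ w.length ∣ n ∧ periodicExt w = m := by
  classical
  have hex : ∃ d, 0 < d ∧ Function.Periodic m d := ⟨n, hn, hm⟩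
  set d := Nat.find hex with hd
  obtain ⟨hd0, hdm⟩ := Nat.find_spec hex
  rw [← hd] at hd0 hdm
  have hleast : ∀ i, 0 < i → i < d → ¬ Function.Periodic m i :=
    fun i hi hid hp => Nat.find_min hex hid ⟨hi, hp⟩
  have hdn : d ∣ n := by
    by_contra hnd
    refine hleast (n % d) (Nat.pos_of_ne_zero fun h => hnd (Nat.dvd_of_mod_eq_zero h))
      (Nat.mod_lt _ hd0) fun j => ?_
    rw [← hm j, ← hdm.map_mod_nat, ← hdm.map_mod_nat (j + n)]
    simp
  have hext : periodicExt ((List.range d).map m) = m := by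
    funext j
    have : j % d < d := Nat.mod_lt _ hd0
    simp [periodicExt, this, hdm.map_mod_nat]
  refine ⟨(List.range d).map m, isLyndon_iff.2 ⟨?_, ?_⟩, by simpa using hdn, hext⟩
  · simp; omega
  · rw [hext]
    intro i hi hid
    refine lt_of_le_of_ne (hmin i) fun h => ?_
    exact hleast i hi (by simpa using hid) fun j => (congrFun (toLex.injective h) j).symm

theorem skew_eq_sum (w : List Bool) :
    skew w = ∑ i ∈ range w.length, letterSign (periodicExt w i) := by
  have h : w.map (fun b => if b then (-1 : ℤ) else 1) =
      (List.range w.length).map (fun i => letterSign (periodicExt w i)) := by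
    refine List.ext_getElem (by simp) fun i h₁ h₂ => ?_
    simp at h₁
    simp [periodicExt_of_lt h₁, letterSign]
  rw [skew, h]
  rfl

theorem Function.Periodic.sum_range_shift {f : ℕ → ℤ} {d : ℕ} (hf : Function.Periodic f d)
    (j : ℕ) : ∑ i ∈ range d, f (j + i) = ∑ i ∈ range d, f i := by
  induction j with
  | zero => simp
  | succ j ih =>
    rw [← ih]
    have h1 := sum_range_succ (fun i => f (j + i)) d
    rw [sum_range_succ', hf] at h1
    simp only [add_zero] at h1
    rw [← add_right_cancel h1]
    exact sum_congr rfl fun i _ => by ring_nf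

/-- The cyclic word of length `n` read off the periodic extension of `w` from position `i` on. -/
def cyclicWord (n : ℕ) (w : List Bool) (i : ℕ) (z : ZMod n) : Bool := periodicExt w (z.val + i)

theorem cyclicWord_natCast {n : ℕ} {w : List Bool} (hw : w.length ∣ n) (i j : ℕ) :
    cyclicWord n w i j = periodicExt w (j + i) := by
  rw [cyclicWord, ZMod.val_natCast, ← (periodic_periodicExt w).map_mod_nat,
    ← (periodic_periodicExt w).map_mod_nat (j + i), Nat.add_mod, Nat.mod_mod_of_dvd _ hw,
    ← Nat.add_mod]

theorem sum_cyclicWord {n : ℕ} [NeZero n] (w : List Bool) :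
    ∑ i ∈ range w.length, ∑ z : ZMod n, letterSign (cyclicWord n w i z) = n * skew w := by
  rw [sum_comm]
  have : ∀ z : ZMod n, ∑ i ∈ range w.length, letterSign (cyclicWord n w i z) = skew w := by
    intro z
    rw [skew_eq_sum]
    exact Function.Periodic.sum_range_shift (f := fun i => letterSign (periodicExt w i))
      (fun i => congrArg letterSign (periodic_periodicExt w i)) z.val
  simp [this, ZMod.card]

theorem cyclicWord_injective {n : ℕ} {u v : List Bool} {i k : ℕ} (hu : IsLyndon u)
    (hv : IsLyndon v) (hun : u.length ∣ n) (hvn : v.length ∣ n) (hi : i < u.length)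
    (hk : k < v.length) (h : cyclicWord n u i = cyclicWord n v k) : u = v ∧ i = k := by
  have hs : ∀ j, periodicExt u (j + i) = periodicExt v (j + k) := fun j => by
    rw [← cyclicWord_natCast hun, ← cyclicWord_natCast hvn, h]
  have key : ∀ {u v : List Bool} {i k : ℕ}, IsLyndon v → i < u.length →
      (∀ j, periodicExt u (j + i) = periodicExt v (j + k)) →
      toLex (periodicExt v) ≤ toLex (periodicExt u) := by
    intro u v i k hv hi hs
    have : periodicExt u = fun j => periodicExt v (j + (u.length - i + k)) := by
      funext j
      rw [← add_assoc, ← hs, add_assoc, Nat.sub_add_cancel hi.le, periodic_periodicExt u]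
    rw [this]
    exact hv.le_shift _
  obtain rfl := hu.eq_of_periodicExt_eq hv
    (toLex.injective (le_antisymm (key hu hk fun j => (hs j).symm) (key hv hi hs)))
  refine ⟨rfl, ?_⟩
  have key' : ∀ {i k : ℕ}, i < u.length → k < u.length →
      (∀ j, periodicExt u (j + i) = periodicExt u (j + k)) → k ≤ i := by
    intro i k hi hk hs
    have := hu.eq_zero_of_shift_eq (i := k - i) (by omega) fun j => by
      by_cases hik : i ≤ k
      · have := hs (j + (u.length - i))
        rw [add_assoc, Nat.sub_add_cancel hi.le, periodic_periodicExt u] at this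
        rw [this, show j + (u.length - i) + k = j + (k - i) + u.length by omega,
          periodic_periodicExt u]
      · rw [Nat.sub_eq_zero_of_le (by omega), add_zero]
    omega
  exact le_antisymm (key' hk hi fun j => (hs j).symm) (key' hi hk hs)

theorem cyclicWord_mem_rotationBelow {n : ℕ} [NeZero n] {w : List Bool} (hw : w.length ∣ n)
    {v : ℕ → Bool} (hlt : toLex (periodicExt w) < toLex v) (i : ℕ) :
    cyclicWord n w i ∈ rotationBelow n v := by
  simp only [rotationBelow, mem_filter, mem_univ, true_and]
  refine ⟨((-(i : ZMod n)).val : ZMod n), ?_⟩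
  convert hlt using 3 with j
  rw [← Nat.cast_add, cyclicWord_natCast hw]
  have h0 : n ∣ (-(i : ZMod n)).val + i := by
    rw [← ZMod.natCast_eq_zero_iff]
    simp
  obtain ⟨c, hc⟩ := hw.trans h0
  rw [show (-(i : ZMod n)).val + j + i = j + c * w.length by linarith]
  exact (periodic_periodicExt w).nat_mul c j

theorem exists_cyclicWord_eq {n : ℕ} [NeZero n] {v : ℕ → Bool} {u : ZMod n → Bool}
    (hu : u ∈ rotationBelow n v) :
    ∃ w i, IsLyndon w ∧ w.length ∣ n ∧ toLex (periodicExt w) < toLex v ∧ i < w.length ∧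
      cyclicWord n w i = u := by
  simp only [rotationBelow, mem_filter, mem_univ, true_and] at hu
  obtain ⟨s, hs⟩ := hu
  obtain ⟨r, hr⟩ := Finite.exists_min (fun r : ZMod n => toLex (fun j : ℕ => u (r + j)))
  obtain ⟨w, hw, hwn, hwm⟩ := exists_isLyndon_periodicExt_eq (m := fun j : ℕ => u (r + j))
    (Nat.pos_of_ne_zero (NeZero.ne n)) (fun j => by simp) (fun i => by
      convert hr (r + i) using 4 with j
      push_cast
      ring)
  refine ⟨w, (-r).val % w.length, hw, hwn, ?_, Nat.mod_lt _ hw.length_pos, ?_⟩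
  · rw [hwm]
    exact (hr s).trans_lt hs
  · funext z
    rw [cyclicWord, ← (periodic_periodicExt w).map_mod_nat, Nat.add_mod_mod,
      (periodic_periodicExt w).map_mod_nat, hwm]
    simp

/-- Each rotation class of cyclic words of length `n` is enumerated by its Lyndon root. -/
theorem mul_sum_skew {n : ℕ} [NeZero n] (v : ℕ → Bool) (A : Finset (List Bool))
    (hA : ∀ w, w ∈ A ↔ IsLyndon w ∧ w.length ∣ n ∧ toLex (periodicExt w) < toLex v) :
    n * ∑ w ∈ A, skew w = ∑ u ∈ rotationBelow n v, ∑ z, letterSign (u z) := by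
  rw [mul_sum]
  simp_rw [← sum_cyclicWord (n := n)]
  rw [sum_sigma']
  refine sum_nbij (fun x => cyclicWord n x.1 x.2) ?_ ?_ ?_ fun _ _ => rfl
  · rintro ⟨w, i⟩ h
    obtain ⟨hw, -⟩ := mem_sigma.1 h
    obtain ⟨-, hwn, hlt⟩ := (hA w).1 hw
    exact cyclicWord_mem_rotationBelow hwn hlt i
  · rintro ⟨u, i⟩ h ⟨w, k⟩ h' heq
    simp only [coe_sigma, Set.mem_sigma_iff, mem_coe, mem_range, hA] at h h'
    obtain ⟨rfl, rfl⟩ :=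
      cyclicWord_injective h.1.1 h'.1.1 h.1.2.1 h'.1.2.1 h.2 h'.2 heq
    rfl
  · intro u hu
    obtain ⟨w, i, hw, hwn, hlt, hi, rfl⟩ := exists_cyclicWord_eq hu
    exact ⟨⟨w, i⟩, by simp [hA, hw, hwn, hlt, hi], rfl⟩

theorem mem_allWords {n : ℕ} {w : List Bool} : w ∈ allWords n ↔ w.length = n := by
  induction n generalizing w with
  | zero => simp [allWords]
  | succ n ih =>
    simp only [allWords, List.mem_flatMap, ih, List.mem_cons, List.not_mem_nil, or_false]
    constructor
    · rintro ⟨x, hx, rfl | rfl⟩ <;> simp [hx]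
    · intro h
      have hw : w ≠ [] := by rintro rfl; simp at h
      refine ⟨w.dropLast, by simp [h], ?_⟩
      rw [← List.dropLast_append_getLast hw]
      cases w.getLast hw <;> simp

theorem nodup_allWords (n : ℕ) : (allWords n).Nodup := by
  induction n with
  | zero => simp [allWords]
  | succ n ih =>
    rw [allWords, List.nodup_flatMap]
    refine ⟨fun w _ => by simp, ih.imp fun {a b} hab => ?_⟩
    simp [Function.onFun, Ne.symm hab]

/-- The Lyndon words of length dividing `n`, in lexicographic order. -/
def sortedLyndon (n : ℕ) : List (List Bool) :=
  List.insertionSort lexLe (((List.range (n + 1)).flatMap allWords).filter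
    (fun w => decide (IsLyndon w) && decide (w.length ∣ n)))

theorem mem_sortedLyndon {n : ℕ} (hn : 0 < n) {w : List Bool} :
    w ∈ sortedLyndon n ↔ IsLyndon w ∧ w.length ∣ n := by
  simp only [sortedLyndon, (List.perm_insertionSort lexLe _).mem_iff, List.mem_filter,
    List.mem_flatMap, List.mem_range, mem_allWords, Bool.and_eq_true, decide_eq_true_eq]
  refine and_iff_right_of_imp fun h => ⟨_, ?_, rfl⟩
  have := Nat.le_of_dvd hn h.2
  omega

theorem nodup_sortedLyndon (n : ℕ) : (sortedLyndon n).Nodup := by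
  rw [sortedLyndon, (List.perm_insertionSort lexLe _).nodup_iff]
  refine List.Nodup.filter _ (List.nodup_flatMap.2 ⟨fun k _ => nodup_allWords k, ?_⟩)
  refine List.nodup_range.imp fun {a b} hab w ha hb => hab ?_
  rw [← mem_allWords.1 ha, ← mem_allWords.1 hb]

theorem lexLe_iff_le (u v : List Bool) : lexLe u v ↔ u ≤ v := by
  rw [lexLe, lexLt_iff_lt, le_iff_lt_or_eq]

theorem pairwise_sortedLyndon (n : ℕ) : (sortedLyndon n).Pairwise lexLt := by
  have : Std.Total lexLe := ⟨fun u v => by simpa only [lexLe_iff_le] using le_total u v⟩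
  have : IsTrans (List Bool) lexLe :=
    ⟨fun u v w => by simpa only [lexLe_iff_le] using le_trans⟩
  have h : (sortedLyndon n).Pairwise lexLe := List.pairwise_insertionSort lexLe _
  exact (h.and (nodup_sortedLyndon n)).imp fun h => h.1.resolve_right h.2

theorem mem_take_iff_lexLt {l : List (List Bool)} (hl : l.Pairwise lexLt) {t : ℕ}
    (ht : t < l.length) {w : List Bool} : w ∈ l.take t ↔ w ∈ l ∧ lexLt w l[t] := by
  rw [List.pairwise_iff_getElem] at hl
  constructor
  · intro h
    obtain ⟨j, hj, rfl⟩ := List.mem_take_iff_getElem.1 h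
    exact ⟨List.getElem_mem _, hl j t _ ht (by omega)⟩
  · rintro ⟨h, hlt⟩
    obtain ⟨j, hj, rfl⟩ := List.mem_iff_getElem.1 h
    refine List.mem_take_iff_getElem.2 ⟨j, ?_, rfl⟩
    by_contra hjt
    rw [lexLt_iff_lt] at hlt
    rcases (show t ≤ j by omega).eq_or_lt with rfl | h'
    · exact lt_irrefl _ hlt
    · exact hlt.asymm (hl t j ht hj h')

theorem skew_append (u v : List Bool) : skew (u ++ v) = skew u + skew v := by
  simp [skew]

theorem skew_flatten (l : List (List Bool)) : skew l.flatten = (l.map skew).sum := by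
  induction l with
  | nil => simp [skew]
  | cons a l ih => simp [skew_append, ih]

theorem abs_skew_le (w : List Bool) : |skew w| ≤ w.length := by
  rw [skew_eq_sum]
  refine (abs_sum_le_sum_abs _ _).trans ?_
  simp [abs_letterSign]

theorem exists_take_flatten_eq {α : Type*} {l : List (List α)} (hl : l ≠ []) (M : ℕ) :
    ∃ t, ∃ ht : t < l.length, ∃ r, l.flatten.take M = (l.take t).flatten ++ l[t].take r := by
  induction l generalizing M with
  | nil => exact absurd rfl hl
  | cons a l ih =>
    by_cases h : l = []
    · subst h
      exact ⟨0, by simp, M, by simp⟩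
    · rcases le_total M a.length with hM | hM
      · exact ⟨0, by simp, M, by simp [List.take_append_of_le_length hM]⟩
      · obtain ⟨t, ht, r, hr⟩ := ih h (M - a.length)
        refine ⟨t + 1, by simpa using ht, r, ?_⟩
        simp [List.take_append, List.take_of_length_le hM, hr]

theorem disc_le {w : List Bool} {B : ℤ} (hB : 0 ≤ B) (h : ∀ M, |skew (w.take M)| ≤ B) :
    disc w ≤ B := by
  have : ∀ l : List ℕ, (l.map (fun M => |skew (w.take (M + 1))|)).foldr max 0 ≤ B := by
    intro l
    induction l with
    | nil => simpa using hB
    | cons a l ih => simpa using ⟨h (a + 1), ih⟩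
  exact this _

theorem mul_disc_LWord_le {n K : ℕ} (hn : 0 < n) (hK : n ^ 2 ≤ 2 ^ K) {B : ℤ}
    (hB : 2 ^ n * (K + 1) ≤ n * B) : disc (LWord n) ≤ B + n := by
  have : NeZero n := ⟨hn.ne'⟩
  have hn' : (0 : ℤ) < n := by exact_mod_cast hn
  have hB0 : 0 ≤ B := by
    refine nonneg_of_mul_nonneg_right (le_trans ?_ hB) hn'
    positivity
  refine disc_le (by positivity) fun M => ?_
  change |skew ((sortedLyndon n).flatten.take M)| ≤ B + n
  by_cases hnil : sortedLyndon n = []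
  · simp [hnil, skew]
    positivity
  obtain ⟨t, ht, r, htake⟩ := exists_take_flatten_eq hnil M
  obtain ⟨hv, hvn⟩ := (mem_sortedLyndon hn).1 (List.getElem_mem ht)
  rw [htake, skew_append, skew_flatten,
    ← List.sum_toFinset skew ((nodup_sortedLyndon n).sublist (List.take_sublist _ _))]
  set v := (sortedLyndon n)[t]
  have htail : |skew (v.take r)| ≤ n := by
    refine (abs_skew_le _).trans ?_
    have := Nat.le_of_dvd hn hvn
    simp only [List.length_take]
    omega
  have hhead : |∑ w ∈ ((sortedLyndon n).take t).toFinset, skew w| ≤ B := by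
    have h := mul_sum_skew (n := n) (periodicExt v) ((sortedLyndon n).take t).toFinset
      fun w => by
        rw [List.mem_toFinset, mem_take_iff_lexLt (pairwise_sortedLyndon n) ht,
          mem_sortedLyndon hn, and_assoc]
        refine and_congr_right fun hw => and_congr_right fun _ => ?_
        exact lexLt_iff_of_isLyndon hw hv
    have h2 := abs_sum_rotationBelow_le (n := n) (periodicExt v) hK
    rw [← h, abs_mul, abs_of_pos hn'] at h2
    exact le_of_mul_le_mul_left (h2.trans hB) hn'
  exact (abs_add_le _ _).trans (add_le_add hhead htail)

theorem sq_le_two_mul_two_pow (n : ℕ) : n ^ 2 ≤ 2 * 2 ^ n := by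
  induction n with
  | zero => simp
  | succ n ih =>
    rcases le_or_gt n 2 with h | h
    · interval_cases n <;> norm_num
    · rw [pow_succ 2 n]
      nlinarith

end

/-- Upper bound: `disc(L_n) ≤ C · 2^n · log n / n` for all `n ≥ 2`. -/
theorem disc_LWord_upper :
    ∃ C > (0 : ℝ), ∀ n : ℕ, 2 ≤ n →
      (disc (LWord n) : ℝ) ≤ C * 2 ^ n * Real.log n / n := by
  refine ⟨16, by norm_num, fun n hn => ?_⟩
  have hn0 : (0 : ℝ) < n := by exact_mod_cast (by omega : 0 < n)
  have hlog2 : (1 : ℝ) / 2 ≤ Real.log 2 := by linarith [Real.log_two_gt_d9]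
  have hlog : (1 : ℝ) / 2 ≤ Real.log n :=
    hlog2.trans (Real.log_le_log (by norm_num) (by exact_mod_cast hn))
  set K := Nat.clog 2 (n ^ 2) with hKdef
  have hK : n ^ 2 ≤ 2 ^ K := Nat.le_pow_clog one_lt_two _
  have hKlog : (K : ℝ) + 1 ≤ 8 * Real.log n := by
    have h1 : 2 ^ K.pred < n ^ 2 := Nat.pow_pred_clog_lt_self one_lt_two (by nlinarith)
    have h2 : ((2 : ℝ) ^ K.pred) ≤ (n : ℝ) ^ 2 := by exact_mod_cast h1.le
    have h3 := Real.log_le_log (by positivity) h2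
    rw [Real.log_pow, Real.log_pow] at h3
    have h4 : (K : ℝ) ≤ K.pred + 1 := by
      exact_mod_cast (by rw [Nat.pred_eq_sub_one]; omega : K ≤ K.pred + 1)
    have h5 : (K.pred : ℝ) * (1 / 2) ≤ K.pred * Real.log 2 := by gcongr
    push_cast at h3
    linarith
  set B : ℤ := ⌈(2 : ℝ) ^ n * (K + 1) / n⌉ with hBdef
  have hB : (2 : ℤ) ^ n * (K + 1) ≤ n * B := by
    have h := Int.le_ceil ((2 : ℝ) ^ n * (K + 1) / n)
    rw [← hBdef, div_le_iff₀ hn0, mul_comm _ (n : ℝ)] at h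
    exact_mod_cast h
  have hdisc : (disc (LWord n) : ℝ) ≤ B + n := by
    exact_mod_cast mul_disc_LWord_le (by omega) hK hB
  have hBle : (B : ℝ) ≤ 2 ^ n * (K + 1) / n + 1 := (Int.ceil_lt_add_one _).le
  have hsq : (n : ℝ) ^ 2 ≤ 2 * 2 ^ n := by exact_mod_cast sq_le_two_mul_two_pow n
  have hn1 : (1 : ℝ) ≤ n := by exact_mod_cast (by omega : 1 ≤ n)
  have hpow : (2 : ℝ) ^ n * (K + 1) ≤ 2 ^ n * (8 * Real.log n) := by gcongr
  have hpow' : (2 : ℝ) ^ n * (1 / 2) ≤ 2 ^ n * Real.log n := by gcongr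
  refine hdisc.trans ?_
  rw [le_div_iff₀ hn0]
  have hBn : (B : ℝ) * n ≤ 2 ^ n * (K + 1) + n := by
    calc (B : ℝ) * n ≤ (2 ^ n * (K + 1) / n + 1) * n := by gcongr
      _ = _ := by field_simp
  nlinarith
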